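/- Fix 0 ≤ t ≤ T and consider the linear time-varying system ẋ(s) = A(s)x(s) + B(s)u(s) with A : [0,T] → ℝ^{n×n} and B : [0,T] → ℝ^{n×m} continuous, input constraint u(s) ∈ E(p,P) with P symmetric positive definite, and terminal set 𝒳 = E(x_e, X_e) with X_e symmetric positive definite; let 𝒢(t) = {x ∈ ℝⁿ | ∃ measurable u : [t,T] → E(p,P) with the corresponding solution from x at time t reaching 𝒳 at time T}. For i = 1, …, n_q, let κ_i : [0,T] → (0,∞) be continuous, and let q_i : [0,T] → ℝⁿ and Q_i : [0,T] → ℝ^{n×n}, with Q_i(t) symmetric positive definite for every t, solve the final value problem q̇_i(t) = A(t)q_i(t) + B(t)p, Q̇_i(t) = A(t)Q_i(t) + Q_i(t)A(t)ᵀ − (1/κ_i(t)) B(t)PB(t)ᵀ − κ_i(t) Q_i(t) for a.e. t ∈ (0,T), with q_i(T) = x_e and Q_i(T) = X_e. Then 𝒢(t) is contained in the intersection ⋂_{i=1}^{n_q} E(q_i(t), Q_i(t)) for every t ∈ [0,T]. -/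

import Mathlib

open scoped RealInnerProductSpace
open Matrix Set

noncomputable section

/-- Action of a matrix on a Euclidean vector. -/
def mv {k l : ℕ} (M : Matrix (Fin k) (Fin l) ℝ) (x : EuclideanSpace ℝ (Fin l)) :
    EuclideanSpace ℝ (Fin k) :=
  (EuclideanSpace.equiv (Fin k) ℝ).symm (M.mulVec ((EuclideanSpace.equiv (Fin l) ℝ) x))

/-- The ellipsoid `E(q, Q) = {x | ⟨x − q, Q⁻¹(x − q)⟩ ≤ 1}`. -/
def ellipsoid {k : ℕ} (q : EuclideanSpace ℝ (Fin k)) (Q : Matrix (Fin k) (Fin k) ℝ) :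
    Set (EuclideanSpace ℝ (Fin k)) :=
  {x | ⟪x - q, mv Q⁻¹ (x - q)⟫ ≤ 1}

/-- A measurable control valued in `U` on `[t, T]`. -/
def Admissible {α : Type*} [MeasurableSpace α] (U : Set α) (t T : ℝ) (u : ℝ → α) : Prop :=
  Measurable u ∧ ∀ s ∈ Set.Icc t T, u s ∈ U

/-- The backwards reachable set of the LTV system `ẋ = A(s)x + B(s)u`, `u(s) ∈ E(p,P)`,
with target `E(xe, Xe)` at time `T`, evaluated at time `t`. -/
def ReachLTV {n m : ℕ} (A : ℝ → Matrix (Fin n) (Fin n) ℝ) (B : ℝ → Matrix (Fin n) (Fin m) ℝ)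
    (p : EuclideanSpace ℝ (Fin m)) (P : Matrix (Fin m) (Fin m) ℝ)
    (xe : EuclideanSpace ℝ (Fin n)) (Xe : Matrix (Fin n) (Fin n) ℝ)
    (T t : ℝ) : Set (EuclideanSpace ℝ (Fin n)) :=
  {x | ∃ (u : ℝ → EuclideanSpace ℝ (Fin m)) (X : ℝ → EuclideanSpace ℝ (Fin n)),
    Admissible (ellipsoid p P) t T u ∧ ContinuousOn X (Set.Icc t T) ∧
    (∀ s ∈ Set.Icc t T, X s = x + ∫ r in t..s, (mv (A r) (X r) + mv (B r) (u r))) ∧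
    X T ∈ ellipsoid xe Xe}

open MeasureTheory
lemma quad_ineq {m : ℕ} {P : Matrix (Fin m) (Fin m) ℝ} (hP : P.PosDef) {k : ℝ} (hk : 0 < k)
    (z v : Fin m → ℝ) (hv : v ⬝ᵥ (P⁻¹ *ᵥ v) ≤ 1) :
    0 ≤ 2 * (z ⬝ᵥ v) + k⁻¹ * (z ⬝ᵥ (P *ᵥ z)) + k := by
  have hdet : IsUnit P.det := hP.det_pos.ne'.isUnit
  have h1 := hP.posSemidef.dotProduct_mulVec_nonneg (z + k • (P⁻¹ *ᵥ v))
  have hPv : P *ᵥ (P⁻¹ *ᵥ v) = v := by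
    rw [mulVec_mulVec, mul_nonsing_inv _ hdet, one_mulVec]
  have hsym : Pᵀ = P := by simpa using hP.isHermitian.eq
  have h2 : (P⁻¹ *ᵥ v) ⬝ᵥ (P *ᵥ z) = z ⬝ᵥ v := by
    rw [dotProduct_mulVec, ← mulVec_transpose, hsym, hPv, dotProduct_comm]
  simp only [star_trivial, mulVec_add, mulVec_smul, hPv, add_dotProduct, dotProduct_add,
    smul_dotProduct, dotProduct_smul, h2, smul_eq_mul] at h1
  rw [dotProduct_comm (P⁻¹ *ᵥ v) v] at h1
  have h3 : 0 ≤ z ⬝ᵥ (P *ᵥ z) + 2 * k * (z ⬝ᵥ v) + k * k := by nlinarith [mul_pos hk hk]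
  have h4 : 2 * (z ⬝ᵥ v) + k⁻¹ * (z ⬝ᵥ (P *ᵥ z)) + k
    = k⁻¹ * (z ⬝ᵥ (P *ᵥ z) + 2 * k * (z ⬝ᵥ v) + k * k) := by field_simp; ring
  rw [h4]; positivity

lemma ac_mono {F : ℝ → ℝ} {a b : ℝ} (hab : a ≤ b) (hF : AbsolutelyContinuousOnInterval F a b)
    (h : ∀ᵐ s, s ∈ Icc a b → 0 ≤ deriv F s) : F a ≤ F b := by
  have h1 := hF.integral_deriv_eq_sub
  have h2 : 0 ≤ ∫ s in a..b, deriv F s := by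
    apply intervalIntegral.integral_nonneg_of_ae_restrict hab
    exact (ae_restrict_iff' measurableSet_Icc).2 h
  linarith

lemma ac_of_hasDerivAt {f f' : ℝ → ℝ} {a b : ℝ} (hab : a ≤ b)
    (h : ∀ s ∈ Icc a b, HasDerivAt f (f' s) s) (hc : ContinuousOn f' (Icc a b)) :
    AbsolutelyContinuousOnInterval f a b := by
  obtain ⟨C, hC⟩ := isCompact_Icc.exists_bound_of_continuousOn hc
  have : LipschitzOnWith (Real.toNNReal C) f (uIcc a b) := by
    rw [uIcc_of_le hab]
    apply (convex_Icc a b).lipschitzOnWith_of_nnnorm_hasDerivWithin_le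
      (fun s hs => (h s hs).hasDerivWithinAt)
    intro s hs
    rw [← NNReal.coe_le_coe, coe_nnnorm]
    exact (hC s hs).trans (Real.le_coe_toNNReal C)
  exact this.absolutelyContinuousOnInterval

lemma ac_sum {ι : Type*} (S : Finset ι) {f : ι → ℝ → ℝ} {a b : ℝ}
    (h : ∀ i ∈ S, AbsolutelyContinuousOnInterval (f i) a b) :
    AbsolutelyContinuousOnInterval (fun s => ∑ i ∈ S, f i s) a b := by
  classical
  induction S using Finset.induction_on with
  | empty => 
    simp only [Finset.sum_empty]
    exact (LipschitzOnWith.absolutelyContinuousOnInterval (K := 0) 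
      ((LipschitzWith.const (0:ℝ)).lipschitzOnWith))
  | insert i S hi ih =>
    simp only [Finset.sum_insert hi]
    exact (h i (by simp)).fun_add (ih fun j hj => h j (by simp [hj]))

section
attribute [local instance] Matrix.linftyOpNormedRing Matrix.linftyOpNormedAlgebra
lemma inv_hasDerivAt {n : ℕ} {Q : ℝ → Matrix (Fin n) (Fin n) ℝ} {Q' : Matrix (Fin n) (Fin n) ℝ}
    {s : ℝ} (hu : IsUnit (Q s)) 
    (h : ∀ j k, HasDerivAt (fun r => Q r j k) (Q' j k) s) (j k : Fin n) :
    HasDerivAt (fun r => (Q r)⁻¹ j k) ((-((Q s)⁻¹ * Q' * (Q s)⁻¹)) j k) s := by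
  have hQ : HasDerivAt Q Q' s := by
    have : HasDerivAt (fun r => (fun j k => Q r j k : Fin n → Fin n → ℝ)) (fun j k => Q' j k) s :=
      hasDerivAt_pi.2 fun j => hasDerivAt_pi.2 fun k => h j k
    let L : (Fin n → Fin n → ℝ) →ₗ[ℝ] Matrix (Fin n) (Fin n) ℝ := 
      { toFun := fun f => Matrix.of f, map_add' := fun _ _ => rfl, map_smul' := fun _ _ => rfl }
    exact (L.toContinuousLinearMap.hasFDerivAt).comp_hasDerivAt s this
  obtain ⟨U, hU⟩ := hu
  have h1 := hasFDerivAt_ringInverse (𝕜 := ℝ) U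
  rw [hU] at h1
  have h2 := h1.comp_hasDerivAt s hQ
  let M : Matrix (Fin n) (Fin n) ℝ →ₗ[ℝ] ℝ := 
    { toFun := fun f => f j k, map_add' := fun _ _ => rfl, map_smul' := fun _ _ => rfl }
  have h3 := (M.toContinuousLinearMap.hasFDerivAt).comp_hasDerivAt s h2
  have hUi : (↑U⁻¹ : Matrix (Fin n) (Fin n) ℝ) = (Q s)⁻¹ := by
    rw [← hU, Matrix.coe_units_inv]
  simp only [Function.comp_def, ← nonsing_inv_eq_ringInverse] at h3
  rw [← hUi]
  exact h3
end

lemma quad_hasDerivAt {n : ℕ} {y : ℝ → Fin n → ℝ} {R : ℝ → Matrix (Fin n) (Fin n) ℝ}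
    {y' : Fin n → ℝ} {R' : Matrix (Fin n) (Fin n) ℝ} {s : ℝ}
    (hy : ∀ i, HasDerivAt (fun r => y r i) (y' i) s)
    (hR : ∀ i j, HasDerivAt (fun r => R r i j) (R' i j) s) :
    HasDerivAt (fun r => y r ⬝ᵥ (R r *ᵥ y r))
      (y' ⬝ᵥ (R s *ᵥ y s) + y s ⬝ᵥ (R' *ᵥ y s + R s *ᵥ y')) s := by
  have h : HasDerivAt (fun r => ∑ i, y r i * ∑ j, R r i j * y r j)
      (∑ i, (y' i * (∑ j, R s i j * y s j) + y s i * ∑ j, (R' i j * y s j + R s i j * y' j))) s :=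
    HasDerivAt.fun_sum fun i _ => (hy i).mul (HasDerivAt.fun_sum fun j _ => (hR i j).mul (hy j))
  have e : y' ⬝ᵥ (R s *ᵥ y s) + y s ⬝ᵥ (R' *ᵥ y s + R s *ᵥ y') =
      ∑ i, (y' i * (∑ j, R s i j * y s j) + y s i * ∑ j, (R' i j * y s j + R s i j * y' j)) := by
    simp only [dotProduct, mulVec, Pi.add_apply, Finset.sum_add_distrib]
  rw [e]
  exact h

lemma ac_quad {n : ℕ} {y : ℝ → Fin n → ℝ} {R : ℝ → Matrix (Fin n) (Fin n) ℝ} {a b : ℝ}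
    (hy : ∀ i, AbsolutelyContinuousOnInterval (fun r => y r i) a b)
    (hR : ∀ i j, AbsolutelyContinuousOnInterval (fun r => R r i j) a b) :
    AbsolutelyContinuousOnInterval (fun r => y r ⬝ᵥ (R r *ᵥ y r)) a b := by
  have h : AbsolutelyContinuousOnInterval
      (fun r => ∑ i, y r i * ∑ j, R r i j * y r j) a b := by
    refine ac_sum _ (f := fun i r => y r i * ∑ j, R r i j * y r j) fun i _ => ?_
    refine (hy i).fun_mul ?_
    exact ac_sum _ (f := fun j r => R r i j * y r j) fun j _ => (hR i j).fun_mul (hy j)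
  exact h

lemma quad_deriv_ge {n m : ℕ} {A Q : Matrix (Fin n) (Fin n) ℝ} {B : Matrix (Fin n) (Fin m) ℝ}
    {P : Matrix (Fin m) (Fin m) ℝ} (hP : P.PosDef) (hQ : Q.PosDef) {k : ℝ} (hk : 0 < k)
    (y : Fin n → ℝ) (v : Fin m → ℝ) (hv : v ⬝ᵥ (P⁻¹ *ᵥ v) ≤ 1) :
    k * (y ⬝ᵥ (Q⁻¹ *ᵥ y) - 1) ≤
      (A *ᵥ y + B *ᵥ v) ⬝ᵥ (Q⁻¹ *ᵥ y) +
        y ⬝ᵥ ((-(Q⁻¹ * (A * Q + Q * Aᵀ - (k⁻¹ • (B * P * Bᵀ) + k • Q)) * Q⁻¹)) *ᵥ y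
          + Q⁻¹ *ᵥ (A *ᵥ y + B *ᵥ v)) := by
  have hdet : IsUnit Q.det := hQ.det_pos.ne'.isUnit
  have hsym : Qᵀ = Q := by simpa using hQ.isHermitian.eq
  have hsymi : (Q⁻¹)ᵀ = Q⁻¹ := by rw [transpose_nonsing_inv, hsym]
  obtain ⟨w, hw⟩ : ∃ w, w = Q⁻¹ *ᵥ y := ⟨_, rfl⟩
  have hQw : Q *ᵥ w = y := by
    rw [hw, mulVec_mulVec, mul_nonsing_inv _ hdet, one_mulVec]
  have hR : ∀ z : Fin n → ℝ, y ⬝ᵥ (Q⁻¹ *ᵥ z) = w ⬝ᵥ z := by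
    intro z
    rw [dotProduct_mulVec, ← mulVec_transpose, hsymi, hw]
  have hq := quad_ineq hP hk (Bᵀ *ᵥ w) v hv
  have e1 : (Bᵀ *ᵥ w) ⬝ᵥ v = w ⬝ᵥ (B *ᵥ v) := by
    rw [dotProduct_mulVec, ← mulVec_transpose]
  have e2 : (Bᵀ *ᵥ w) ⬝ᵥ (P *ᵥ (Bᵀ *ᵥ w)) = w ⬝ᵥ (B *ᵥ (P *ᵥ (Bᵀ *ᵥ w))) := by
    rw [dotProduct_mulVec w, ← mulVec_transpose]
  have e3 : w ⬝ᵥ (Q *ᵥ (Aᵀ *ᵥ w)) = w ⬝ᵥ (A *ᵥ y) := by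
    rw [dotProduct_mulVec w, ← mulVec_transpose, hsym, hQw, dotProduct_comm, mulVec_transpose,
      ← dotProduct_mulVec]
  rw [e1, e2] at hq
  simp only [neg_mulVec, dotProduct_add, dotProduct_neg, ← mulVec_mulVec, hR, ← hw, add_mulVec,
    sub_mulVec, smul_mulVec, hQw, dotProduct_sub, dotProduct_smul, smul_eq_mul, e3, add_dotProduct]
  rw [dotProduct_comm (A *ᵥ y) w, dotProduct_comm (B *ᵥ v) w, dotProduct_comm y w]
  linarith

lemma core {n m : ℕ} {t T : ℝ} (htT : t ≤ T)
    {A Q : ℝ → Matrix (Fin n) (Fin n) ℝ} {B : ℝ → Matrix (Fin n) (Fin m) ℝ}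
    {P : Matrix (Fin m) (Fin m) ℝ} (hP : P.PosDef) {κ : ℝ → ℝ}
    (hA : ContinuousOn A (Icc t T)) (hB : ContinuousOn B (Icc t T))
    (hκ : ContinuousOn κ (Icc t T)) (hκ0 : ∀ s ∈ Icc t T, 0 < κ s)
    (hQ0 : ∀ s ∈ Icc t T, (Q s).PosDef) (hQ : ContinuousOn Q (Icc t T))
    (hQd : ∀ s ∈ Ioo t T, ∀ j k, HasDerivAt (fun r => Q r j k)
      ((A s * Q s + Q s * (A s)ᵀ - ((κ s)⁻¹ • (B s * P * (B s)ᵀ) + κ s • Q s)) j k) s)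
    {y : ℝ → Fin n → ℝ} {v : ℝ → Fin m → ℝ} (hv : ∀ s ∈ Icc t T, v s ⬝ᵥ (P⁻¹ *ᵥ v s) ≤ 1)
    (hy : ContinuousOn y (Icc t T))
    (hyac : ∀ a b, t < a → a ≤ b → b < T → ∀ i,
      AbsolutelyContinuousOnInterval (fun s => y s i) a b)
    (hyd : ∀ᵐ s, s ∈ Ioo t T → ∀ i, HasDerivAt (fun r => y r i) ((A s *ᵥ y s + B s *ᵥ v s) i) s)
    (hT : y T ⬝ᵥ ((Q T)⁻¹ *ᵥ y T) ≤ 1) : y t ⬝ᵥ ((Q t)⁻¹ *ᵥ y t) ≤ 1 := by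
  rcases htT.eq_or_lt with rfl | hlt
  · exact hT
  have hA' := continuousOn_iff_continuous_domRestrict.1 hA
  have hB' := continuousOn_iff_continuous_domRestrict.1 hB
  have hκ' := continuousOn_iff_continuous_domRestrict.1 hκ
  have hQ' := continuousOn_iff_continuous_domRestrict.1 hQ
  have hy' := continuousOn_iff_continuous_domRestrict.1 hy
  have hκi : Continuous ((Icc t T).domRestrict fun s => (κ s)⁻¹) := by
    apply hκ'.inv₀
    intro s; exact (hκ0 s s.2).ne'
  have hR' : Continuous ((Icc t T).domRestrict fun s => (Q s)⁻¹) := by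
    have : (Icc t T).domRestrict (fun s => (Q s)⁻¹) =
        fun s : Icc t T => (Q s).det⁻¹ • (Q s).adjugate := by
      funext s
      simp [Matrix.inv_def]
    rw [this]
    exact (hQ'.matrix_det.inv₀ fun s => (hQ0 s s.2).det_pos.ne').smul hQ'.matrix_adjugate
  have hVc : ContinuousOn (fun s => y s ⬝ᵥ ((Q s)⁻¹ *ᵥ y s)) (Icc t T) :=
    continuousOn_iff_continuous_domRestrict.2 (hy'.dotProduct (hR'.matrix_mulVec hy'))
  have hRd : ∀ s ∈ Ioo t T, ∀ j k, HasDerivAt (fun r => (Q r)⁻¹ j k)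
      ((-((Q s)⁻¹ * (A s * Q s + Q s * (A s)ᵀ - ((κ s)⁻¹ • (B s * P * (B s)ᵀ) + κ s • Q s))
        * (Q s)⁻¹)) j k) s := fun s hs j k =>
    inv_hasDerivAt (hQ0 s (Ioo_subset_Icc_self hs)).isUnit (hQd s hs) j k
  have hRdc : ∀ j k, ContinuousOn (fun s =>
      ((-((Q s)⁻¹ * (A s * Q s + Q s * (A s)ᵀ - ((κ s)⁻¹ • (B s * P * (B s)ᵀ) + κ s • Q s))
        * (Q s)⁻¹)) j k)) (Icc t T) := by
    intro j k
    apply continuousOn_iff_continuous_domRestrict.2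
    refine Continuous.matrix_elem (A := (Icc t T).domRestrict fun s => 
      (-((Q s)⁻¹ * (A s * Q s + Q s * (A s)ᵀ - ((κ s)⁻¹ • (B s * P * (B s)ᵀ) + κ s • Q s))
        * (Q s)⁻¹))) ?_ j k
    refine ((hR'.matrix_mul (((hA'.matrix_mul hQ').add (hQ'.matrix_mul hA'.matrix_transpose)).sub
      ((hκi.smul ((hB'.matrix_mul continuous_const).matrix_mul hB'.matrix_transpose)).add
        (hκ'.smul hQ')))).matrix_mul hR').neg
  -- integrating factor
  let k : ℝ → ℝ := IccExtend htT ((Icc t T).domRestrict κ)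
  have hkc : Continuous k := hκ'.Icc_extend'
  have hkκ : ∀ s ∈ Icc t T, k s = κ s := fun s hs => by
    simp [k, IccExtend_of_mem htT _ hs]
  let E : ℝ → ℝ := fun s => Real.exp (-∫ r in t..s, k r)
  have hE : ∀ s, HasDerivAt E (E s * -k s) s := fun s =>
    (hkc.integral_hasStrictDerivAt t s).hasDerivAt.neg.exp
  have hEc : Continuous E := continuous_iff_continuousAt.2 fun s => (hE s).continuousAt
  let F : ℝ → ℝ := fun s => E s * (y s ⬝ᵥ ((Q s)⁻¹ *ᵥ y s) - 1)
  have hFc : ContinuousOn F (Icc t T) := hEc.continuousOn.mul (hVc.sub continuousOn_const)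
  have hF : ∀ a b, t < a → a ≤ b → b < T → F a ≤ F b := by
    intro a b ha hab hb
    have hsub : Icc a b ⊆ Ioo t T := fun s hs => ⟨ha.trans_le hs.1, hs.2.trans_lt hb⟩
    have hsub' : Icc a b ⊆ Icc t T := hsub.trans Ioo_subset_Icc_self
    have hRac : ∀ i j, AbsolutelyContinuousOnInterval (fun s => (Q s)⁻¹ i j) a b := fun i j =>
      ac_of_hasDerivAt hab (fun s hs => hRd s (hsub hs) i j) ((hRdc i j).mono hsub')
    have hEac : AbsolutelyContinuousOnInterval E a b :=
      ac_of_hasDerivAt hab (fun s _ => hE s) (hEc.mul hkc.neg).continuousOn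
    have hyac' := hyac a b ha hab hb
    have hVac : AbsolutelyContinuousOnInterval (fun s => y s ⬝ᵥ ((Q s)⁻¹ *ᵥ y s)) a b :=
      ac_quad hyac' hRac
    have h1ac : AbsolutelyContinuousOnInterval (fun _ : ℝ => (1:ℝ)) a b :=
      ac_of_hasDerivAt hab (fun s _ => hasDerivAt_const s 1) continuousOn_const
    apply ac_mono hab (hEac.fun_mul (hVac.fun_sub h1ac))
    filter_upwards [hyd] with s hs hsab
    have hsI := hsub hsab
    have hsI' := hsub' hsab
    have hd := quad_hasDerivAt (hs hsI) (hRd s hsI)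
    have hFd := (hE s).mul (hd.sub_const 1)
    have hge := quad_deriv_ge (A := A s) (B := B s) hP (hQ0 s hsI') (hκ0 s hsI') (y s) (v s)
      (hv s hsI')
    refine le_of_le_of_eq ?_ hFd.deriv.symm
    rw [hkκ s hsI']
    have hEpos : 0 < E s := Real.exp_pos _
    have := mul_le_mul_of_nonneg_left hge hEpos.le
    linarith
  obtain ⟨c, hc⟩ := exists_between hlt
  have h1 : F t ≤ F c := by
    have : Filter.Tendsto F (nhdsWithin t (Ioo t T)) (nhds (F t)) :=
      (hFc t ⟨le_rfl, htT⟩).mono Ioo_subset_Icc_self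
    rw [nhdsWithin_Ioo_eq_nhdsGT hlt] at this
    refine le_of_tendsto this ?_
    filter_upwards [Ioo_mem_nhdsGT hc.1] with s hs
    exact hF s c hs.1 hs.2.le hc.2
  have h2 : F c ≤ F T := by
    have : Filter.Tendsto F (nhdsWithin T (Ioo t T)) (nhds (F T)) :=
      (hFc T ⟨htT, le_rfl⟩).mono Ioo_subset_Icc_self
    rw [nhdsWithin_Ioo_eq_nhdsLT hlt] at this
    refine ge_of_tendsto this ?_
    filter_upwards [Ioo_mem_nhdsLT hc.2] with s hs
    exact hF c s hc.1 hs.1.le hs.2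
  have h3 : F T ≤ 0 := mul_nonpos_of_nonneg_of_nonpos (Real.exp_pos _).le (by linarith)
  have h4 : F t = y t ⬝ᵥ ((Q t)⁻¹ *ᵥ y t) - 1 := by simp [F, E]
  linarith

lemma inner_mv {k : ℕ} (M : Matrix (Fin k) (Fin k) ℝ) (z : EuclideanSpace ℝ (Fin k)) :
    ⟪z, mv M z⟫ = z.ofLp ⬝ᵥ (M *ᵥ z.ofLp) := by
  have h : ⟪z, mv M z⟫ = ∑ i, (M *ᵥ z.ofLp) i * z.ofLp i := by
    rw [PiLp.inner_apply]; rfl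
  rw [h, dotProduct_comm]; rfl

lemma mv_apply {k l : ℕ} (M : Matrix (Fin k) (Fin l) ℝ) (z : EuclideanSpace ℝ (Fin l)) (i : Fin k) :
    mv M z i = (M *ᵥ z.ofLp) i := rfl

lemma cont_mulVec {k l : ℕ} {M : ℝ → Matrix (Fin k) (Fin l) ℝ} {z : ℝ → Fin l → ℝ} {S : Set ℝ}
    {i : Fin k} (hM : ∀ j, ContinuousOn (fun r => M r i j) S)
    (hz : ∀ j, ContinuousOn (fun r => z r j) S) :
    ContinuousOn (fun r => (M r *ᵥ z r) i) S := by
  have h : ContinuousOn (fun r => ∑ j, M r i j * z r j) S :=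
    continuousOn_finsetSum _ fun j _ => (hM j).mul (hz j)
  exact h

lemma ell_bound {m : ℕ} {P : Matrix (Fin m) (Fin m) ℝ} (hP : P.PosDef)
    (v : Fin m → ℝ) (hv : v ⬝ᵥ (P⁻¹ *ᵥ v) ≤ 1) (j : Fin m) : |v j| ≤ P j j + 1 := by
  have h1 := quad_ineq hP one_pos (Pi.single j 1) v hv
  have h2 := quad_ineq hP one_pos (-Pi.single j 1) v hv
  have h3 : 0 < P j j := hP.diag_pos
  simp only [mulVec_neg, neg_dotProduct, dotProduct_neg, neg_neg] at h2
  simp at h1 h2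
  rw [abs_le]
  constructor <;> linarith

/-- The intersection of the ellipsoids `E(qᵢ(t), Qᵢ(t))` generated by the over-approximating
final value problem over-approximates the backwards reachable set of the LTV system. -/
theorem ellipsoidal_over_approx_BRS {n m : ℕ} (T : ℝ) (hT : 0 ≤ T)
    (A : ℝ → Matrix (Fin n) (Fin n) ℝ) (hA : ContinuousOn A (Set.Icc 0 T))
    (B : ℝ → Matrix (Fin n) (Fin m) ℝ) (hB : ContinuousOn B (Set.Icc 0 T))
    (p : EuclideanSpace ℝ (Fin m)) (P : Matrix (Fin m) (Fin m) ℝ) (hP : P.PosDef)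
    (xe : EuclideanSpace ℝ (Fin n)) (Xe : Matrix (Fin n) (Fin n) ℝ) (hXe : Xe.PosDef)
    (nq : ℕ)
    (qm : Fin nq → ℝ → EuclideanSpace ℝ (Fin n))
    (Qm : Fin nq → ℝ → Matrix (Fin n) (Fin n) ℝ)
    (κm : Fin nq → ℝ → ℝ)
    (hκ_cont : ∀ i, ContinuousOn (κm i) (Set.Icc 0 T))
    (hκ_pos : ∀ i, ∀ t ∈ Set.Icc (0 : ℝ) T, 0 < κm i t)
    (hQpos : ∀ i, ∀ t ∈ Set.Icc (0 : ℝ) T, (Qm i t).PosDef)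
    (hq_cont : ∀ i, ContinuousOn (qm i) (Set.Icc 0 T))
    (hQ_cont : ∀ i, ContinuousOn (Qm i) (Set.Icc 0 T))
    (hq_ode : ∀ i, ∀ t ∈ Set.Ioo (0 : ℝ) T,
      HasDerivAt (qm i) (mv (A t) (qm i t) + mv (B t) p) t)
    (hQ_ode : ∀ i, ∀ t ∈ Set.Ioo (0 : ℝ) T, ∀ j k : Fin n,
      HasDerivAt (fun s => Qm i s j k)
        ((A t * Qm i t + Qm i t * (A t)ᵀ -
          ((κm i t)⁻¹ • (B t * P * (B t)ᵀ) + κm i t • Qm i t)) j k) t)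
    (hqT : ∀ i, qm i T = xe) (hQT : ∀ i, Qm i T = Xe) :
    ∀ t ∈ Set.Icc (0 : ℝ) T,
      ReachLTV A B p P xe Xe T t ⊆ ⋂ i : Fin nq, ellipsoid (qm i t) (Qm i t) := by
  intro t ht x hx
  obtain ⟨u, X, ⟨hum, hu⟩, hXc, hX, hXT⟩ := hx
  rw [mem_iInter]
  intro i
  have hsub : Icc t T ⊆ Icc 0 T := Icc_subset_Icc_left ht.1
  have hsubo : Ioo t T ⊆ Ioo 0 T := Ioo_subset_Ioo_left ht.1
  have hA1 := hA.mono hsub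
  have hB1 := hB.mono hsub
  have hAe : ∀ i j, ContinuousOn (fun r => A r i j) (Icc t T) := fun i j =>
    (continuous_id.matrix_elem i j).comp_continuousOn hA1
  have hBe : ∀ i j, ContinuousOn (fun r => B r i j) (Icc t T) := fun i j =>
    (continuous_id.matrix_elem i j).comp_continuousOn hB1
  have hXe : ∀ j, ContinuousOn (fun r => X r j) (Icc t T) := fun j =>
    (EuclideanSpace.proj (𝕜 := ℝ) j).continuous.comp_continuousOn hXc
  have hqe : ∀ j, ContinuousOn (fun r => qm i r j) (Icc t T) := fun j =>
    (EuclideanSpace.proj (𝕜 := ℝ) j).continuous.comp_continuousOn ((hq_cont i).mono hsub)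
  have hv : ∀ s ∈ Icc t T, (u s - p).ofLp ⬝ᵥ (P⁻¹ *ᵥ (u s - p).ofLp) ≤ 1 := by
    intro s hs
    rw [← inner_mv]
    exact hu s hs
  have hui : ∀ j, IntervalIntegrable (fun r => u r j) volume t T := by
    intro j
    rw [intervalIntegrable_iff_integrableOn_Icc_of_le ht.2]
    apply Measure.integrableOn_of_bounded (M := |p j| + (P j j + 1)) measure_Icc_lt_top.ne
    · exact ((EuclideanSpace.proj (𝕜 := ℝ) j).continuous.measurable.comp hum).aestronglyMeasurable
    · refine (ae_restrict_iff' measurableSet_Icc).2 (Filter.Eventually.of_forall fun s hs => ?_)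
      have := ell_bound hP _ (hv s hs) j
      have h2 : u s j = p j + (u s - p).ofLp j := by simp
      rw [h2, Real.norm_eq_abs]
      exact (abs_add_le _ _).trans (by linarith)
  have hgi : ∀ j, IntervalIntegrable
      (fun r => (A r *ᵥ (X r).ofLp) j + (B r *ᵥ (u r).ofLp) j) volume t T := by
    intro j
    apply IntervalIntegrable.add
    · apply ContinuousOn.intervalIntegrable
      rw [uIcc_of_le ht.2]
      exact cont_mulVec (hAe j) hXe
    · have : IntervalIntegrable (fun r => ∑ k, B r j k * u r k) volume t T := by
        have := IntervalIntegrable.sum (μ := volume) (a := t) (b := T) Finset.univ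
          (f := fun k r => B r j k * u r k) fun k _ => (hui k).continuousOn_mul
            (by rw [uIcc_of_le ht.2]; exact hBe j k)
        have e : (fun r => ∑ k, B r j k * u r k) = ∑ k, fun r => B r j k * u r k := by
          funext r
          simp
        rw [e]
        exact this
      exact this
  have hg : IntervalIntegrable (fun r => mv (A r) (X r) + mv (B r) (u r)) volume t T := by
    rw [intervalIntegrable_iff]
    apply Integrable.of_eval_piLp
    intro j
    exact intervalIntegrable_iff.1 (hgi j)
  have hXj : ∀ s ∈ Icc t T, ∀ j, X s j = x j +
      ∫ r in t..s, ((A r *ᵥ (X r).ofLp) j + (B r *ᵥ (u r).ofLp) j) := by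
    intro s hs j
    have hgs : IntervalIntegrable (fun r => mv (A r) (X r) + mv (B r) (u r)) volume t s :=
      hg.mono_set (by rw [uIcc_of_le hs.1, uIcc_of_le ht.2]; exact Icc_subset_Icc_right hs.2)
    have h1 := (EuclideanSpace.proj (𝕜 := ℝ) j).intervalIntegral_comp_comm hgs
    have h2 := congrArg (EuclideanSpace.proj (𝕜 := ℝ) j) (hX s hs)
    rw [map_add, ← h1] at h2
    exact h2
  let y : ℝ → Fin n → ℝ := fun s j => x j +
      (∫ r in t..s, ((A r *ᵥ (X r).ofLp) j + (B r *ᵥ (u r).ofLp) j)) - qm i s j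
  have hyX : ∀ s ∈ Icc t T, y s = (X s - qm i s).ofLp := by
    intro s hs
    funext j
    simp only [y, ← hXj s hs j]
    rfl
  have hXt : X t = x := by simpa using hX t ⟨le_rfl, ht.2⟩
  have hqd : ∀ s ∈ Ioo t T, ∀ j, HasDerivAt (fun r => qm i r j)
      ((A s *ᵥ (qm i s).ofLp) j + (B s *ᵥ p.ofLp) j) s := by
    intro s hs j
    exact (EuclideanSpace.proj (𝕜 := ℝ) j).hasFDerivAt.comp_hasDerivAt s (hq_ode i s (hsubo hs))
  have key := core (y := y) (v := fun s => (u s - p).ofLp) ht.2 hP hA1 hB1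
    ((hκ_cont i).mono hsub) (fun s hs => hκ_pos i s (hsub hs)) (fun s hs => hQpos i s (hsub hs))
    ((hQ_cont i).mono hsub) (fun s hs => hQ_ode i s (hsubo hs)) hv ?_ ?_ ?_ ?_
  · rw [hyX t ⟨le_rfl, ht.2⟩, hXt, ← inner_mv] at key
    exact key
  · refine ContinuousOn.congr ?_ hyX
    exact continuousOn_pi.2 fun j => (hXe j).sub (hqe j)
  · intro a b ha hab hb j
    have hs1 : Icc a b ⊆ Ioo t T := fun s hs => ⟨ha.trans_le hs.1, hs.2.trans_lt hb⟩
    have hs2 : Icc a b ⊆ Icc t T := hs1.trans Ioo_subset_Icc_self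
    have h1 := (hgi j).absolutelyContinuousOnInterval_intervalIntegral (c := t) left_mem_uIcc
    have h2 := h1.mono (c := a) (d := b) (by rwa [uIcc_of_le hab, uIcc_of_le ht.2])
    have h3 : AbsolutelyContinuousOnInterval (fun r => qm i r j) a b := by
      apply ac_of_hasDerivAt hab (fun s hs => hqd s (hs1 hs) j)
      refine ContinuousOn.mono ?_ hs2
      exact (cont_mulVec (hAe j) hqe).add (cont_mulVec (hBe j) fun _ => continuousOn_const)
    have h4 : AbsolutelyContinuousOnInterval (fun _ : ℝ => x j) a b :=
      ac_of_hasDerivAt hab (fun s _ => hasDerivAt_const s _) continuousOn_const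
    exact (h4.fun_add h2).fun_sub h3
  · have h1 := ae_all_iff.2 fun j => (hgi j).ae_hasDerivAt_integral
    filter_upwards [h1] with s hs hsI j
    have hsI' := Ioo_subset_Icc_self hsI
    have h2 := hs j (by rwa [uIcc_of_le ht.2]) t left_mem_uIcc
    have h3 := (h2.const_add (x j)).sub (hqd s hsI j)
    have e : (A s *ᵥ y s + B s *ᵥ (u s - p).ofLp) j =
        (A s *ᵥ (X s).ofLp) j + (B s *ᵥ (u s).ofLp) j -
          ((A s *ᵥ (qm i s).ofLp) j + (B s *ᵥ p.ofLp) j) := by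
      rw [hyX s hsI', WithLp.ofLp_sub, WithLp.ofLp_sub, mulVec_sub, mulVec_sub]
      simp only [Pi.add_apply, Pi.sub_apply]
      ring
    rw [e]
    exact h3
  · rw [hyX T ⟨ht.2, le_rfl⟩, ← inner_mv, hqT, hQT]
    exact hXT

end
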